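/- arXiv:2504.09735 — 2 statements merged into one kernel-verified Lean document; each statement's English description precedes it below -/
import Mathlib

section
/- Let x, s, u ∈ ℂ be nonzero with x² ≠ 1, and λ, ε ∈ ℝ. Writing f_{x,s} := f_{x,s,u,λ,ε}, for every z ∈ ℂ∖{0} at which all occurring functions are defined one has q^{−ε}·f_{x,s}(z/q) = a⁻(x,s)·f_{qx, s/q}(z) + a⁻(x⁻¹,s)·f_{x/q, s/q}(z) and also q^{−ε}·f_{x,s}(z/q) = a⁺(x,s)·f_{qx, sq}(z) + a⁺(x⁻¹,s)·f_{x/q, sq}(z), where a⁻(x,s) := −x q^ε/(s(1−x²)) and a⁺(x,s) := q^{−ε}(1−sxq^{1−2iλ})(1−sxq^{1+2iλ})/(1−x²). -/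
noncomputable section

open Complex

/-- `q^{iλ} := exp(iλ · log q)`. -/
def qil (q lam : ℝ) : ℂ := Complex.exp (Complex.I * lam * Real.log q)

/-- the real power `q^a` viewed as a complex number. -/
def qr (q a : ℝ) : ℂ := ((q ^ a : ℝ) : ℂ)

/-- the infinite `q`-shifted factorial `(w;p)_∞ = ∏_{j≥0} (1 - w p^j)`. -/
def qPoch (w p : ℂ) : ℂ := ∏' j : ℕ, (1 - w * p ^ j)

/-- the theta function `θ(w;p) = (w;p)_∞ (p/w;p)_∞`. -/
def qTheta (w p : ℂ) : ℂ := qPoch w p * qPoch (p / w) p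

/-- `μ_s = (s + s⁻¹)/(q⁻¹ - q)`. -/
def mu (q : ℝ) (s : ℂ) : ℂ := (s + s⁻¹) / ((q : ℂ)⁻¹ - (q : ℂ))

/-- The eigenfunction
`f_{x,s,u,λ,ε}(z) = (sq^{1−2iλ}x^{±1}, uszq^{1+iλ};q²)_∞ θ(q^{2ε−iλ}uz/s;q²) /
(uzq^{−iλ}x^{±1}, sq^{1−iλ}/(uz);q²)_∞`. -/
def fAW (q lam eps : ℝ) (x s u : ℂ) (z : ℂ) : ℂ :=
  (qPoch (s * (q : ℂ) * ((qil q lam)⁻¹) ^ 2 * x) ((q : ℂ) ^ 2) *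
    qPoch (s * (q : ℂ) * ((qil q lam)⁻¹) ^ 2 / x) ((q : ℂ) ^ 2) *
    qPoch (u * s * z * (q : ℂ) * qil q lam) ((q : ℂ) ^ 2) *
    qTheta (qr q (2 * eps) * (qil q lam)⁻¹ * u * z / s) ((q : ℂ) ^ 2)) /
  (qPoch (u * z * (qil q lam)⁻¹ * x) ((q : ℂ) ^ 2) *
    qPoch (u * z * (qil q lam)⁻¹ / x) ((q : ℂ) ^ 2) *
    qPoch (s * (q : ℂ) * (qil q lam)⁻¹ / (u * z)) ((q : ℂ) ^ 2))

/-- the denominator of `f_{x,s,u,λ,ε}` at the point `z`. -/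
def fDen (q lam : ℝ) (x s u : ℂ) (z : ℂ) : ℂ :=
  qPoch (u * z * (qil q lam)⁻¹ * x) ((q : ℂ) ^ 2) *
    qPoch (u * z * (qil q lam)⁻¹ / x) ((q : ℂ) ^ 2) *
    qPoch (s * (q : ℂ) * (qil q lam)⁻¹ / (u * z)) ((q : ℂ) ^ 2)

/-- the coefficient `a⁻(x,s) = −xq^ε/(s(1−x²))`. -/
def aminus (q eps : ℝ) (s x : ℂ) : ℂ := -(x * qr q eps) / (s * (1 - x ^ 2))

/-- the coefficient `a⁺(x,s) = q^{−ε}(1−sxq^{1−2iλ})(1−sxq^{1+2iλ})/(1−x²)`. -/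
def aplus (q lam eps : ℝ) (s x : ℂ) : ℂ :=
  qr q (-eps) * (1 - s * x * (q : ℂ) * ((qil q lam)⁻¹) ^ 2) *
    (1 - s * x * (q : ℂ) * (qil q lam) ^ 2) / (1 - x ^ 2)

theorem qPoch_step (w p : ℂ) (hp : ‖p‖ < 1) : qPoch w p = (1 - w) * qPoch (w * p) p := by
  have hm : Multipliable (fun j : ℕ => 1 - w * p ^ (j + 1)) := by
    have h : Summable (fun j : ℕ => ‖-(w * p ^ (j + 1))‖) := by
      simp only [norm_neg, norm_mul, norm_pow]
      exact ((summable_nat_add_iff 1).2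
        (summable_geometric_of_lt_one (norm_nonneg p) hp)).mul_left _
    simpa [sub_eq_add_neg] using multipliable_one_add_of_summable h
  have h := tprod_eq_zero_mul' (f := fun j : ℕ => 1 - w * p ^ j) hm
  have h2 : (fun j : ℕ => 1 - w * p ^ (j + 1)) = fun j : ℕ => 1 - w * p * p ^ j := by
    funext j
    rw [pow_succ', mul_assoc]
  rw [h2, pow_zero, mul_one] at h
  exact h

theorem qPoch_step' (w v p : ℂ) (hp : ‖p‖ < 1) (h : w * p = v) :
    qPoch w p = (1 - w) * qPoch v p := by
  rw [qPoch_step w p hp, h]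

theorem qTheta_step (w v p : ℂ) (hp : ‖p‖ < 1) (hp0 : p ≠ 0) (hw : w ≠ 0) (h : w * p = v) :
    qTheta v p = -(1 / w) * qTheta w p := by
  subst h
  unfold qTheta
  rw [qPoch_step w p hp, qPoch_step' (p / (w * p)) (p / w) p hp (by field_simp)]
  field_simp
  ring

/-- the purely algebraic content of the first identity -/
theorem alg_minus (q L e x s y t W : ℂ) (A B C T X Y G : ℂ) (hq : q ≠ 0)
    (he : e ≠ 0) (hx : x ≠ 0) (hs : s ≠ 0) (hx2 : x ^ 2 ≠ 1) (hW : W ≠ 0)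
    (h1 : 1 - W * x / q ≠ 0) (h2 : 1 - W / (x * q) ≠ 0) (h3 : 1 - y / W ≠ 0)
    (hX : X ≠ 0) (hY : Y ≠ 0) (hG : G ≠ 0) (ht : t = e ^ 2 * W / (s * q)) :
    e⁻¹ * ((A * B * C * T) / (((1 - W * x / q) * X) * ((1 - W / (x * q)) * Y) * G))
    = (-(x * e) / (s * (1 - x ^ 2))) * ((A * ((1 - y / (q * x)) * B) * C * (-(1 / t) * T)) /
        (X * ((1 - W / (x * q)) * Y) * ((1 - y / W) * G)))
    + (-(x⁻¹ * e) / (s * (1 - x⁻¹ ^ 2))) * ((((1 - y * x / q) * A) * B * C * (-(1 / t) * T)) /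
        (((1 - W * x / q) * X) * Y * ((1 - y / W) * G))) := by
  have h4 : 1 - x ^ 2 ≠ 0 := sub_ne_zero.2 (Ne.symm hx2)
  have h5 : q - W * x ≠ 0 := by
    intro h; apply h1; field_simp; simpa using h
  have h6 : x * q - W ≠ 0 := by
    intro h; apply h2; field_simp; simpa using h
  have h7 : W - y ≠ 0 := by
    intro h; apply h3; field_simp; simpa using h
  have e1 : 1 - W * x / q = (q - W * x) / q := by field_simp
  have e2 : 1 - W / (x * q) = (x * q - W) / (x * q) := by field_simp
  have e3 : 1 - y / W = (W - y) / W := by field_simp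
  have e4 : 1 - x⁻¹ ^ 2 = -(1 - x ^ 2) / x ^ 2 := by field_simp; ring
  rw [e1, e2, e3, e4, ht]
  clear e1 e2 e3 e4 h1 h2 h3
  obtain ⟨P, hP⟩ : ∃ P, P = q - W * x := ⟨_, rfl⟩
  obtain ⟨Q, hQ⟩ : ∃ Q, Q = x * q - W := ⟨_, rfl⟩
  obtain ⟨R, hR⟩ : ∃ R, R = W - y := ⟨_, rfl⟩
  obtain ⟨S, hS⟩ : ∃ S, S = 1 - x ^ 2 := ⟨_, rfl⟩
  rw [← hP] at h5 ⊢
  rw [← hQ] at h6 ⊢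
  rw [← hR] at h7 ⊢
  rw [← hS] at h4 ⊢
  field_simp
  rw [hP, hQ, hR, hS]
  ring

theorem alg_plus (q L e x m n W : ℂ) (A B C T X Y G : ℂ) (hq : q ≠ 0)
    (hx : x ≠ 0) (hx2 : x ^ 2 ≠ 1)
    (h1 : 1 - W * x / q ≠ 0) (h2 : 1 - W / (x * q) ≠ 0)
    (hX : X ≠ 0) (hY : Y ≠ 0) (hG : G ≠ 0) :
    e * ((((1 - n * x) * A) * ((1 - n / x) * B) * ((1 - W * m / q) * C) * T) /
        (((1 - W * x / q) * X) * ((1 - W / (x * q)) * Y) * G))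
    = (e * (1 - n * x) * (1 - m * x) / (1 - x ^ 2)) * ((A * ((1 - n / x) * B) * C * T) /
        (X * ((1 - W / (x * q)) * Y) * G))
    + (e * (1 - n / x) * (1 - m / x) / (1 - x⁻¹ ^ 2)) * ((((1 - n * x) * A) * B * C * T) /
        (((1 - W * x / q) * X) * Y * G)) := by
  have h4 : 1 - x ^ 2 ≠ 0 := sub_ne_zero.2 (Ne.symm hx2)
  have h5 : q - W * x ≠ 0 := by
    intro h; apply h1; field_simp; simpa using h
  have h6 : x * q - W ≠ 0 := by
    intro h; apply h2; field_simp; simpa using h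
  have e1 : 1 - W * x / q = (q - W * x) / q := by field_simp
  have e2 : 1 - W / (x * q) = (x * q - W) / (x * q) := by field_simp
  have e4 : 1 - x⁻¹ ^ 2 = -(1 - x ^ 2) / x ^ 2 := by field_simp; ring
  rw [e1, e2, e4]
  clear e1 e2 e4 h1 h2
  obtain ⟨P, hP⟩ : ∃ P, P = q - W * x := ⟨_, rfl⟩
  obtain ⟨Q, hQ⟩ : ∃ Q, Q = x * q - W := ⟨_, rfl⟩
  obtain ⟨S, hS⟩ : ∃ S, S = 1 - x ^ 2 := ⟨_, rfl⟩
  rw [← hP] at h5 ⊢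
  rw [← hQ] at h6 ⊢
  rw [← hS] at h4 ⊢
  field_simp
  rw [hP, hQ, hS]
  ring

/-- The action of `π_{λ,ε}(K⁻¹)` on `f_{x,s}`:
`q^{−ε}f_{x,s}(z/q) = a⁻(x,s) f_{qx,s/q}(z) + a⁻(x⁻¹,s) f_{x/q,s/q}(z)
                    = a⁺(x,s) f_{qx,sq}(z) + a⁺(x⁻¹,s) f_{x/q,sq}(z)`. -/
theorem stmt3 (q : ℝ) (hq0 : 0 < q) (hq1 : q < 1) (lam eps : ℝ) (x s u : ℂ)
    (hx : x ≠ 0) (hs : s ≠ 0) (hu : u ≠ 0) (hx2 : x ^ 2 ≠ 1) (z : ℂ) (hz : z ≠ 0)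
    (hd0 : fDen q lam x s u (z / (q : ℂ)) ≠ 0)
    (hd1 : fDen q lam ((q : ℂ) * x) (s / (q : ℂ)) u z ≠ 0)
    (hd2 : fDen q lam (x / (q : ℂ)) (s / (q : ℂ)) u z ≠ 0)
    (hd3 : fDen q lam ((q : ℂ) * x) (s * (q : ℂ)) u z ≠ 0)
    (hd4 : fDen q lam (x / (q : ℂ)) (s * (q : ℂ)) u z ≠ 0) :
    qr q (-eps) * fAW q lam eps x s u (z / (q : ℂ))
        = aminus q eps s x * fAW q lam eps ((q : ℂ) * x) (s / (q : ℂ)) u z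
          + aminus q eps s x⁻¹ * fAW q lam eps (x / (q : ℂ)) (s / (q : ℂ)) u z ∧
    qr q (-eps) * fAW q lam eps x s u (z / (q : ℂ))
        = aplus q lam eps s x * fAW q lam eps ((q : ℂ) * x) (s * (q : ℂ)) u z
          + aplus q lam eps s x⁻¹ * fAW q lam eps (x / (q : ℂ)) (s * (q : ℂ)) u z := by
  have hL : qil q lam ≠ 0 := Complex.exp_ne_zero _
  have hq : (q : ℂ) ≠ 0 := by exact_mod_cast hq0.ne'
  have hp0 : (q : ℂ) ^ 2 ≠ 0 := pow_ne_zero 2 hq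
  have hp : ‖(q : ℂ) ^ 2‖ < 1 := by
    rw [norm_pow, Complex.norm_real, Real.norm_eq_abs, abs_of_pos hq0]
    nlinarith
  have he : qr q eps ≠ 0 := by
    unfold qr
    exact_mod_cast (Real.rpow_pos_of_pos hq0 eps).ne'
  have hen : qr q (-eps) = (qr q eps)⁻¹ := by
    unfold qr
    rw [Real.rpow_neg hq0.le]
    push_cast
    rfl
  have he2 : qr q (2 * eps) = qr q eps ^ 2 := by
    unfold qr
    rw [mul_comm, Real.rpow_mul hq0.le]
    norm_cast
  unfold fDen at hd0 hd1
  unfold fAW aminus aplus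
  rw [hen, he2]
  clear hd2 hd3 hd4 hen he2
  generalize qil q lam = L at *
  generalize qr q eps = e at *
  generalize (q : ℂ) = r at *
  have key : ∀ w v : ℂ, w * r ^ 2 = v → qPoch w (r ^ 2) = (1 - w) * qPoch v (r ^ 2) :=
    fun w v h => qPoch_step' w v _ hp h
  obtain ⟨W, hWdef⟩ : ∃ W, W = u * z * L⁻¹ := ⟨_, rfl⟩
  have hW : W ≠ 0 := by rw [hWdef]; positivity
  -- the denominators
  have a1 : qPoch (u * (z / r) * L⁻¹ * x) (r ^ 2)
      = (1 - W * x / r) * qPoch (W * x * r) (r ^ 2) := by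
    rw [key _ (W * x * r) (by rw [hWdef]; field_simp)]; rw [hWdef]; congr 2; field_simp
  have a2 : qPoch (u * (z / r) * L⁻¹ / x) (r ^ 2)
      = (1 - W / (x * r)) * qPoch (W * r / x) (r ^ 2) := by
    rw [key _ (W * r / x) (by rw [hWdef]; field_simp)]; rw [hWdef]; congr 2; field_simp
  have a3 : s * r * L⁻¹ / (u * (z / r)) = s * r ^ 2 * L⁻¹ / (u * z) := by field_simp
  have b1 : u * z * L⁻¹ * (r * x) = W * x * r := by rw [hWdef]; ring
  have b2 : qPoch (u * z * L⁻¹ / (r * x)) (r ^ 2)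
      = (1 - W / (x * r)) * qPoch (W * r / x) (r ^ 2) := by
    rw [key _ (W * r / x) (by rw [hWdef]; field_simp)]; rw [hWdef]; congr 2; field_simp
  have b3 : qPoch (s / r * r * L⁻¹ / (u * z)) (r ^ 2)
      = (1 - (s * L⁻¹ ^ 2) / W) * qPoch (s * r ^ 2 * L⁻¹ / (u * z)) (r ^ 2) := by
    rw [key _ (s * r ^ 2 * L⁻¹ / (u * z)) (by field_simp)]; rw [hWdef]; congr 2; field_simp
  have c1 : qPoch (u * z * L⁻¹ * (x / r)) (r ^ 2)
      = (1 - W * x / r) * qPoch (W * x * r) (r ^ 2) := by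
    rw [key _ (W * x * r) (by rw [hWdef]; field_simp)]; rw [hWdef]; congr 2; field_simp
  have c2 : u * z * L⁻¹ / (x / r) = W * r / x := by rw [hWdef]; field_simp
  have d3 : s * r * r * L⁻¹ / (u * z) = s * r ^ 2 * L⁻¹ / (u * z) := by ring
  rw [a1, a2, a3] at hd0
  rw [b1, b2, b3] at hd1
  simp only [mul_ne_zero_iff] at hd0 hd1
  obtain ⟨⟨⟨h1, hX⟩, h2, hY⟩, hG⟩ := hd0
  have h3 := hd1.2.1
  have t0 : e ^ 2 * L⁻¹ * u * (z / r) / s = e ^ 2 * W / (s * r) := by rw [hWdef]; field_simp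
  have t3 : e ^ 2 * L⁻¹ * u * z / (s * r) = e ^ 2 * W / (s * r) := by rw [hWdef]; field_simp
  have t1 : qTheta (e ^ 2 * L⁻¹ * u * z / (s / r)) (r ^ 2)
      = -(1 / (e ^ 2 * W / (s * r))) * qTheta (e ^ 2 * W / (s * r)) (r ^ 2) := by
    apply qTheta_step _ _ _ hp hp0 (by positivity)
    rw [hWdef]; field_simp
  rw [a1, a2, a3, b1, b2, b3, c1, c2, d3, t0, t1, t3]
  constructor
  · have n1 : s / r * r * L⁻¹ ^ 2 * (r * x) = s * r * L⁻¹ ^ 2 * x := by field_simp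
    have n2 : qPoch (s / r * r * L⁻¹ ^ 2 / (r * x)) (r ^ 2)
        = (1 - (s * L⁻¹ ^ 2) / (r * x)) * qPoch (s * r * L⁻¹ ^ 2 / x) (r ^ 2) := by
      rw [key _ (s * r * L⁻¹ ^ 2 / x) (by field_simp)]; congr 2; field_simp
    have n3 : qPoch (s / r * r * L⁻¹ ^ 2 * (x / r)) (r ^ 2)
        = (1 - (s * L⁻¹ ^ 2) * x / r) * qPoch (s * r * L⁻¹ ^ 2 * x) (r ^ 2) := by
      rw [key _ (s * r * L⁻¹ ^ 2 * x) (by field_simp)]; congr 2; field_simp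
    have n4 : s / r * r * L⁻¹ ^ 2 / (x / r) = s * r * L⁻¹ ^ 2 / x := by field_simp
    have n5 : u * s * (z / r) * r * L = u * s * z * L := by field_simp
    have n6 : u * (s / r) * z * r * L = u * s * z * L := by field_simp
    rw [n1, n2, n3, n4, n5, n6]
    exact alg_minus r L e x s _ _ W _ _ _ _ _ _ _ hq he hx hs hx2 hW h1 h2 h3 hX hY hG rfl
  · have n1 : s * r * r * L⁻¹ ^ 2 * (r * x) = s * r ^ 3 * L⁻¹ ^ 2 * x := by ring
    have n2 : s * r * r * L⁻¹ ^ 2 / (r * x) = s * r * L⁻¹ ^ 2 / x := by field_simp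
    have n3 : s * r * r * L⁻¹ ^ 2 * (x / r) = s * r * L⁻¹ ^ 2 * x := by field_simp
    have n4 : s * r * r * L⁻¹ ^ 2 / (x / r) = s * r ^ 3 * L⁻¹ ^ 2 / x := by field_simp
    have m1 := key (s * r * L⁻¹ ^ 2 * x) (s * r ^ 3 * L⁻¹ ^ 2 * x) (by ring)
    have m2 := key (s * r * L⁻¹ ^ 2 / x) (s * r ^ 3 * L⁻¹ ^ 2 / x) (by ring)
    have m3 : qPoch (u * s * (z / r) * r * L) (r ^ 2)
        = (1 - W * (s * r * L ^ 2) / r) * qPoch (u * (s * r) * z * r * L) (r ^ 2) := by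
      rw [key _ (u * (s * r) * z * r * L) (by field_simp)]; rw [hWdef]; congr 2; field_simp
    have k1 : s * x * r * L⁻¹ ^ 2 = s * r * L⁻¹ ^ 2 * x := by ring
    have k2 : s * x * r * L ^ 2 = s * r * L ^ 2 * x := by ring
    have k3 : s * x⁻¹ * r * L⁻¹ ^ 2 = s * r * L⁻¹ ^ 2 / x := by ring
    have k4 : s * x⁻¹ * r * L ^ 2 = s * r * L ^ 2 / x := by ring
    rw [n1, n2, n3, n4, m1, m2, m3, k1, k2, k3, k4]
    exact alg_plus r L e⁻¹ x _ _ W _ _ _ _ _ _ _ hq hx hx2 h1 h2 hX hY hG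

end
end

section
/- Let λ, ε ∈ ℝ, let s, u, t, v, x ∈ ℂ be nonzero with x² ∉ {1, q², q⁻²}, and set a := sq^{1−2iλ}, b := sq^{1+2iλ}, c := vtq/u, d := vq/(ut). Writing f_x := f_{x,s,u,λ,ε}, for every z ∈ ℂ∖{0} at which all occurring functions are defined one has (π_{λ,ε}(Ỹ_{t,v⁻¹}) f_x)(z) = 𝒜(x)·f_{q²x}(z) + ℬ(x)·f_x(z) + 𝒜(x⁻¹)·f_{x/q²}(z), where 𝒜(x) := (1/(q⁻¹−q))·(1−ax)(1−bx)(1−cx)(1−dx)/((qvs/u)·(1−x²)(1−q²x²)) and ℬ(x) := (qvs/u + u/(qvs))/(q⁻¹−q) − μ_t − 𝒜(x) − 𝒜(x⁻¹). -/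
noncomputable section

open Complex

/-- action of the twisted primitive element `Ỹ_{t,w}` in the representation `π_{λ,ε}`. -/
def piYt (q lam eps : ℝ) (t w : ℂ) (f : ℂ → ℂ) (z : ℂ) : ℂ :=
  qr q (-(2 * eps)) *
      ((t + t⁻¹ - w⁻¹ * z * (q : ℂ)⁻¹ * (qil q lam)⁻¹ - w * z⁻¹ * (q : ℂ) * qil q lam) /
        ((q : ℂ)⁻¹ - (q : ℂ))) * f (z / (q : ℂ) ^ 2)
    + ((w⁻¹ * z * qil q lam + w * z⁻¹ * (qil q lam)⁻¹ - t - t⁻¹) / ((q : ℂ)⁻¹ - (q : ℂ))) * f z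

/-- the coefficient `𝒜(x) = (1/(q⁻¹−q))·(1−ax)(1−bx)(1−cx)(1−dx)/((qvs/u)(1−x²)(1−q²x²))`
with `(a,b,c,d) = (sq^{1−2iλ}, sq^{1+2iλ}, vtq/u, vq/(ut))`. -/
def calA (q lam : ℝ) (s u t v : ℂ) (x : ℂ) : ℂ :=
  (1 / ((q : ℂ)⁻¹ - (q : ℂ))) *
    ((1 - s * (q : ℂ) * ((qil q lam)⁻¹) ^ 2 * x) * (1 - s * (q : ℂ) * (qil q lam) ^ 2 * x) *
      (1 - v * t * (q : ℂ) / u * x) * (1 - v * (q : ℂ) / (u * t) * x)) /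
    (((q : ℂ) * v * s / u) * (1 - x ^ 2) * (1 - (q : ℂ) ^ 2 * x ^ 2))

/-- the coefficient `ℬ(x) = (qvs/u + u/(qvs))/(q⁻¹−q) − μ_t − 𝒜(x) − 𝒜(x⁻¹)`. -/
def calB (q lam : ℝ) (s u t v : ℂ) (x : ℂ) : ℂ :=
  ((q : ℂ) * v * s / u + u / ((q : ℂ) * v * s)) / ((q : ℂ)⁻¹ - (q : ℂ)) - mu q t
    - calA q lam s u t v x - calA q lam s u t v x⁻¹

theorem rat_id (q k s u t v x y : ℂ) (hq : q ≠ 0) (hqq : 1 - q ^ 2 ≠ 0) (hk : k ≠ 0)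
    (hs : s ≠ 0) (hu : u ≠ 0) (ht : t ≠ 0) (hv : v ≠ 0) (hx : x ≠ 0) (hy : y ≠ 0)
    (h1 : 1 - x ^ 2 ≠ 0) (h2 : 1 - q ^ 2 * x ^ 2 ≠ 0) (h3 : x ^ 2 - q ^ 2 ≠ 0)
    (h4 : q ^ 2 - y * x ≠ 0) (h5 : q ^ 2 * x - y ≠ 0) :
    (t + t⁻¹ - v * (y * k / u) * q⁻¹ * k⁻¹ - v⁻¹ * (y * k / u)⁻¹ * q * k) / (q⁻¹ - q)
      * (-(y / (s * q ^ 2)) * (1 - s * q * k ^ 2 * y / q ^ 2) * (1 - s * q * k⁻¹ ^ 2 / y)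
        / ((1 - y * x / q ^ 2) * (1 - y / (x * q ^ 2))))
      + (v * (y * k / u) * k + v⁻¹ * (y * k / u)⁻¹ * k⁻¹ - t - t⁻¹) / (q⁻¹ - q)
    = (1 / (q⁻¹ - q)) * ((1 - s * q * k ^ 2 * x) * (1 - v * t * q / u * x)
        * (1 - v * q / (u * t) * x)) / ((q * v * s / u) * (1 - x ^ 2) * (1 - q ^ 2 * x ^ 2))
        * ((1 - s * q * k⁻¹ ^ 2 / (q ^ 2 * x)) * (1 - y * x) / (1 - y / (q ^ 2 * x))
          - (1 - s * q * k⁻¹ ^ 2 * x))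
      + ((q * v * s / u + u / (q * v * s)) / (q⁻¹ - q) - (t + t⁻¹) / (q⁻¹ - q))
      + (1 / (q⁻¹ - q)) * ((1 - s * q * k ^ 2 * x⁻¹) * (1 - v * t * q / u * x⁻¹)
        * (1 - v * q / (u * t) * x⁻¹)) / ((q * v * s / u) * (1 - x⁻¹ ^ 2) * (1 - q ^ 2 * x⁻¹ ^ 2))
        * ((1 - s * q * k⁻¹ ^ 2 * x / q ^ 2) * (1 - y / x) / (1 - y * x / q ^ 2)
          - (1 - s * q * k⁻¹ ^ 2 * x⁻¹)) := by
  have e1 : q⁻¹ - q = (1 - q ^ 2) / q := by field_simp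
  have e2 : 1 - y * x / q ^ 2 = (q ^ 2 - y * x) / q ^ 2 := by field_simp
  have e3 : 1 - y / (x * q ^ 2) = (q ^ 2 * x - y) / (q ^ 2 * x) := by field_simp
  have e3' : 1 - y / (q ^ 2 * x) = (q ^ 2 * x - y) / (q ^ 2 * x) := by field_simp
  have e4 : 1 - x⁻¹ ^ 2 = -(1 - x ^ 2) / x ^ 2 := by field_simp; ring
  have e5 : 1 - q ^ 2 * x⁻¹ ^ 2 = (x ^ 2 - q ^ 2) / x ^ 2 := by field_simp
  rw [e1, e2, e3, e3', e4, e5]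
  field_simp
  ring

theorem alg1 (α β γ δ n N2 N3 T d1 D2 D3 : ℂ) (h0 : γ * d1 * D2 * D3 ≠ 0)
    (h1 : d1 * (δ * D2) * D3 ≠ 0) :
    α * (n * (β * N2) * N3 * T / (d1 * (δ * D2) * D3))
      = α * n * N2 * N3 * T / (γ * d1 * D2 * D3) * (β * γ / δ) := by
  simp only [mul_ne_zero_iff] at h0 h1
  obtain ⟨⟨⟨hγ, hd⟩, hD2⟩, hD3⟩ := h0
  have hδ := h1.1.2.1
  field_simp

theorem alg2 (α β γ δ n N1 N3 T d2 D1 D3 : ℂ) (h0 : D1 * (γ * d2) * D3 ≠ 0)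
    (h1 : δ * D1 * d2 * D3 ≠ 0) :
    α * (β * N1 * n * N3 * T / (δ * D1 * d2 * D3))
      = N1 * (α * n) * N3 * T / (D1 * (γ * d2) * D3) * (β * γ / δ) := by
  simp only [mul_ne_zero_iff] at h0 h1
  obtain ⟨⟨hD1, hγ, hd⟩, hD3⟩ := h0
  have hδ := h1.1.1.1
  field_simp

theorem alg3 (e ρ c τ ζ η δ1 δ2 N1 N2 N3 T1 T2 D1 D2 d3 : ℂ)
    (h0 : D1 * D2 * (η * d3) ≠ 0) (h1 : δ1 * D1 * (δ2 * D2) * d3 ≠ 0) (h : e * ρ = c * τ) :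
    e * (N1 * N2 * (ζ * N3) * (ρ * T1 * T2) / (δ1 * D1 * (δ2 * D2) * d3))
      = N1 * N2 * N3 * (T1 * (τ * T2)) / (D1 * D2 * (η * d3)) * (c * ζ * η / (δ1 * δ2)) := by
  simp only [mul_ne_zero_iff] at h0 h1
  obtain ⟨⟨hD1, hD2⟩, hη, hd⟩ := h0
  have hδ1 := h1.1.1.1
  have hδ2 := h1.1.2.1
  field_simp
  linear_combination N1 * N2 * ζ * N3 * T1 * T2 * h

/-- `π_{λ,ε}(Ỹ_{t,v⁻¹})` acts on `f_x` as the Askey–Wilson `q²`-difference operator: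
`π(Ỹ_{t,v⁻¹}) f_x = 𝒜(x) f_{q²x} + ℬ(x) f_x + 𝒜(x⁻¹) f_{x/q²}`. -/
theorem stmt8 (q : ℝ) (hq0 : 0 < q) (hq1 : q < 1) (lam eps : ℝ) (s u t v x : ℂ)
    (hs : s ≠ 0) (hu : u ≠ 0) (ht : t ≠ 0) (hv : v ≠ 0) (hx : x ≠ 0)
    (hx2 : x ^ 2 ≠ 1) (hx2' : x ^ 2 ≠ (q : ℂ) ^ 2) (hx2'' : x ^ 2 ≠ ((q : ℂ) ^ 2)⁻¹)
    (z : ℂ) (hz : z ≠ 0)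
    (hd0 : fDen q lam x s u z ≠ 0)
    (hd1 : fDen q lam x s u (z / (q : ℂ) ^ 2) ≠ 0)
    (hd2 : fDen q lam ((q : ℂ) ^ 2 * x) s u z ≠ 0)
    (hd3 : fDen q lam (x / (q : ℂ) ^ 2) s u z ≠ 0) :
    piYt q lam eps t v⁻¹ (fAW q lam eps x s u) z
      = calA q lam s u t v x * fAW q lam eps ((q : ℂ) ^ 2 * x) s u z
        + calB q lam s u t v x * fAW q lam eps x s u z
        + calA q lam s u t v x⁻¹ * fAW q lam eps (x / (q : ℂ) ^ 2) s u z := by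
  have hqc : (q : ℂ) ≠ 0 := by exact_mod_cast hq0.ne'
  have hQ1 : ‖(q : ℂ) ^ 2‖ < 1 := by
    rw [norm_pow, Complex.norm_real, Real.norm_of_nonneg hq0.le]
    nlinarith
  have hqq : 1 - (q : ℂ) ^ 2 ≠ 0 := by
    intro h
    have h' : (q : ℂ) ^ 2 = 1 := by linear_combination -h
    rw [h'] at hQ1
    simp at hQ1
  have hk : qil q lam ≠ 0 := Complex.exp_ne_zero _
  have hE : qr q (-(2 * eps)) * qr q (2 * eps) = 1 := by
    unfold qr
    rw [← Complex.ofReal_mul, ← Real.rpow_add hq0]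
    simp
  have hEn : qr q (2 * eps) ≠ 0 := right_ne_zero_of_mul_eq_one hE
  have step := fun w => qPoch_step w ((q : ℂ) ^ 2) hQ1
  simp only [piYt, calB, mu, inv_inv]
  generalize hEm : qr q (-(2 * eps)) = E' at *
  generalize hEp : qr q (2 * eps) = E at *
  have key : ∀ x' z' : ℂ, fAW q lam eps x' s u z' =
      (qPoch (s * (q : ℂ) * ((qil q lam)⁻¹) ^ 2 * x') ((q : ℂ) ^ 2) *
    qPoch (s * (q : ℂ) * ((qil q lam)⁻¹) ^ 2 / x') ((q : ℂ) ^ 2) *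
    qPoch (u * s * z' * (q : ℂ) * qil q lam) ((q : ℂ) ^ 2) *
    (qPoch (E * (qil q lam)⁻¹ * u * z' / s) ((q : ℂ) ^ 2) *
      qPoch ((q : ℂ) ^ 2 / (E * (qil q lam)⁻¹ * u * z' / s)) ((q : ℂ) ^ 2))) /
    fDen q lam x' s u z' := by
    intro x' z'
    simp only [fAW, fDen, qTheta, hEp]
  simp only [fDen] at hd0 hd1 hd2 hd3 key
  simp only [calA]
  generalize qil q lam = k at *
  generalize (q : ℂ) = r at *
  obtain ⟨y, rfl⟩ : ∃ y, z = y * k / u := ⟨z * u / k, by field_simp⟩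
  have hy : y ≠ 0 := by rintro rfl; simp at hz
  -- normal forms of the arguments
  have n1 : u * (y * k / u) * k⁻¹ = y := by field_simp
  have n2 : u * (y * k / u / r ^ 2) * k⁻¹ = y / r ^ 2 := by field_simp
  have n3 : s * r * k⁻¹ / (u * (y * k / u)) = s * r * k⁻¹ ^ 2 / y := by field_simp
  have n4 : s * r * k⁻¹ / (u * (y * k / u / r ^ 2)) = s * r * k⁻¹ ^ 2 / y * r ^ 2 := by
    field_simp
  have n5 : u * s * (y * k / u) * r * k = s * r * k ^ 2 * y := by field_simp
  have n6 : u * s * (y * k / u / r ^ 2) * r * k = s * r * k ^ 2 * y / r ^ 2 := by field_simp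
  have n7 : E * k⁻¹ * u * (y * k / u) / s = E * y / s := by field_simp
  have n8 : E * k⁻¹ * u * (y * k / u / r ^ 2) / s = E * y / s / r ^ 2 := by field_simp
  rw [n1, n3] at hd0 hd2 hd3
  rw [n2, n4] at hd1
  have kz := fun x' => key x' (y * k / u)
  have kq := key x (y * k / u / r ^ 2)
  simp only [n1, n3, n5, n7] at kz
  simp only [n2, n4, n6, n8] at kq
  have k0 := kz x
  have k1 := kz (r ^ 2 * x)
  have k2 := kz (x / r ^ 2)
  clear key kz
  generalize fAW q lam eps x s u (y * k / u / r ^ 2) = Fq at *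
  generalize fAW q lam eps x s u (y * k / u) = F at *
  generalize fAW q lam eps (r ^ 2 * x) s u (y * k / u) = F1 at *
  generalize fAW q lam eps (x / r ^ 2) s u (y * k / u) = F2 at *
  have hr2 : r ^ 2 ≠ 0 := pow_ne_zero 2 hqc
  -- step relations
  have up : ∀ w w' : ℂ, w' = w * r ^ 2 → qPoch w (r ^ 2) = (1 - w) * qPoch w' (r ^ 2) := by
    rintro w w' rfl; exact step w
  have s1 := up (y / r ^ 2 * x) (y * x) (by field_simp)
  have s2 := up (y / r ^ 2 / x) (y / x) (by field_simp)
  have s3 := up (s * r * k⁻¹ ^ 2 / y) (s * r * k⁻¹ ^ 2 / y * r ^ 2) rfl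
  have s4 := up (s * r * k ^ 2 * y / r ^ 2) (s * r * k ^ 2 * y) (by field_simp)
  have s5 := up (E * y / s / r ^ 2) (E * y / s) (by field_simp)
  have s6 := up (r ^ 2 / (E * y / s)) (r ^ 2 / (E * y / s / r ^ 2)) (by field_simp)
  have s6b := up (1 / (E * y / s / r ^ 2)) (r ^ 2 / (E * y / s / r ^ 2)) (by field_simp)
  have s6c : 1 / (E * y / s / r ^ 2) = r ^ 2 / (E * y / s) := by field_simp
  have s7 := up (y * x) (y * (r ^ 2 * x)) (by ring)
  have s8 := up (y / (r ^ 2 * x)) (y / x) (by field_simp)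
  have s9 := up (s * r * k⁻¹ ^ 2 * x) (s * r * k⁻¹ ^ 2 * (r ^ 2 * x)) (by ring)
  have s10 := up (s * r * k⁻¹ ^ 2 / (r ^ 2 * x)) (s * r * k⁻¹ ^ 2 / x) (by field_simp)
  have s11 := up (y / x) (y / (x / r ^ 2)) (by field_simp)
  have s12 := up (y * (x / r ^ 2)) (y * x) (by field_simp)
  have s13 := up (s * r * k⁻¹ ^ 2 / x) (s * r * k⁻¹ ^ 2 / (x / r ^ 2)) (by field_simp)
  have s14 := up (s * r * k⁻¹ ^ 2 * (x / r ^ 2)) (s * r * k⁻¹ ^ 2 * x) (by field_simp)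
  clear up step s6b s6c
  rw [s8] at k1 hd2
  rw [s10] at k1
  rw [s12] at k2 hd3
  rw [s14] at k2
  rw [s1, s2, s4, s5] at kq
  rw [s1, s2] at hd1
  rw [s6] at k0 k1 k2
  -- cleared relations
  have H1 : (1 - s * r * k⁻¹ ^ 2 * x) * F1 = F * ((1 - s * r * k⁻¹ ^ 2 / (r ^ 2 * x))
      * (1 - y * x) / (1 - y / (r ^ 2 * x))) := by
    rw [s7] at hd0
    rw [k1, k0, s7, s9]
    exact alg1 _ _ _ _ _ _ _ _ _ _ _ hd0 hd2
  have H2 : (1 - s * r * k⁻¹ ^ 2 * x⁻¹) * F2 = F * ((1 - s * r * k⁻¹ ^ 2 * x / r ^ 2)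
      * (1 - y / x) / (1 - y * x / r ^ 2)) := by
    rw [s11] at hd0
    have e1 : y * (x / r ^ 2) = y * x / r ^ 2 := by ring
    have e2 : s * r * k⁻¹ ^ 2 * (x / r ^ 2) = s * r * k⁻¹ ^ 2 * x / r ^ 2 := by ring
    have e3 : s * r * k⁻¹ ^ 2 * x⁻¹ = s * r * k⁻¹ ^ 2 / x := by ring
    rw [k2, k0, s11, s13, e1, e2, e3]
    rw [e1] at hd3
    exact alg2 _ _ _ _ _ _ _ _ _ _ _ hd0 hd3
  have Hq : E' * Fq = F * (-(y / (s * r ^ 2)) * (1 - s * r * k ^ 2 * y / r ^ 2)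
      * (1 - s * r * k⁻¹ ^ 2 / y) / ((1 - y * x / r ^ 2) * (1 - y / (x * r ^ 2)))) := by
    have e1 : y / r ^ 2 * x = y * x / r ^ 2 := by ring
    have e2 : y / r ^ 2 / x = y / (x * r ^ 2) := by field_simp
    have e3 : E' * (1 - E * y / s / r ^ 2) = -(y / (s * r ^ 2)) * (1 - r ^ 2 / (E * y / s)) := by
      have : E' = 1 / E := by field_simp; exact hE
      rw [this]; field_simp; ring
    rw [s3] at hd0
    rw [kq, k0, s3]
    rw [e1, e2] at hd1 ⊢
    have A := fun N1 N2 N3 T1 T2 => alg3 _ _ _ _ (1 - s * r * k ^ 2 * y / r ^ 2) _ _ _ N1 N2 N3 T1 T2 _ _ _ hd0 hd1 e3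
    exact A _ _ _ _ _
  have g1 : 1 - x ^ 2 ≠ 0 := fun h => hx2 (by linear_combination -h)
  have g3 : x ^ 2 - r ^ 2 ≠ 0 := fun h => hx2' (by linear_combination h)
  have g2 : 1 - r ^ 2 * x ^ 2 ≠ 0 := fun h => hx2'' (by field_simp; linear_combination -h)
  have g4 : r ^ 2 - y * x ≠ 0 := by
    intro h
    apply hd1
    have : 1 - y / r ^ 2 * x = 0 := by field_simp; linear_combination h
    rw [this]; ring
  have g5 : r ^ 2 * x - y ≠ 0 := by
    intro h
    apply hd1
    have : 1 - y / r ^ 2 / x = 0 := by field_simp; linear_combination h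
    rw [this]; ring
  have R := rat_id r k s u t v x y hqc hqq hk hs hu ht hv hx hy g1 g2 g3 g4 g5
  linear_combination F * R
    + ((t + t⁻¹ - v * (y * k / u) * r⁻¹ * k⁻¹ - v⁻¹ * (y * k / u)⁻¹ * r * k) / (r⁻¹ - r)) * Hq
    - ((1 / (r⁻¹ - r)) * ((1 - s * r * k ^ 2 * x) * (1 - v * t * r / u * x)
        * (1 - v * r / (u * t) * x)) / ((r * v * s / u) * (1 - x ^ 2) * (1 - r ^ 2 * x ^ 2))) * H1
    - ((1 / (r⁻¹ - r)) * ((1 - s * r * k ^ 2 * x⁻¹) * (1 - v * t * r / u * x⁻¹)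
        * (1 - v * r / (u * t) * x⁻¹))
        / ((r * v * s / u) * (1 - x⁻¹ ^ 2) * (1 - r ^ 2 * x⁻¹ ^ 2))) * H2

end
end
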